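/- Let α < 0, θ > −α and N ∈ ℕ₀. Then the Beta–Bernoulli weights V^{BB,α,θ}(N) form an (α,θ)-solution: Σ_{j=0}^{∞} V^{BB,α,θ}_{1,j}(N) = 1 and, for every n ∈ ℕ and k ∈ ℕ₀, V^{BB,α,θ}_{n,k}(N) = Σ_{j=0}^{∞} C(k+j, j) ((θ+α)_{n↑})^j (θ+n)^k V^{BB,α,θ}_{n+1,k+j}(N) (the sum is finite since V^{BB,α,θ}_{n+1,k+j}(N) = 0 for k+j > N). -/

import Mathlib

open scoped BigOperators

/-- Rising factorial `(x)_{j↑} = x(x+1)⋯(x+j-1)`. -/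
noncomputable def risingFac (x : ℝ) (j : ℕ) : ℝ :=
  ∏ i ∈ Finset.range j, (x + i)

/-- Beta–Bernoulli weights `V^{BB,α,θ}_{n,k}(N)`. -/
noncomputable def VBB (α θ : ℝ) (N n k : ℕ) : ℝ :=
  (Nat.choose N k : ℝ) * ((-α) * Real.Gamma (θ + α) / Real.Gamma (θ + α + n)) ^ k *
    (Real.Gamma (θ + α + n) * Real.Gamma θ /
      (Real.Gamma (θ + α) * Real.Gamma (θ + n))) ^ N

/-- The binomial series with exponent `M`, written as a series over `ℕ`. -/
theorem hasSum_choose_mul_pow (M : ℕ) (x : ℝ) :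
    HasSum (fun j : ℕ => (M.choose j : ℝ) * x ^ j) ((1 + x) ^ M) := by
  have h : (1 + x) ^ M = ∑ j ∈ Finset.range (M + 1), (M.choose j : ℝ) * x ^ j := by
    rw [add_comm, add_pow]
    exact Finset.sum_congr rfl fun j _ => by rw [one_pow]; ring
  rw [h]
  refine hasSum_sum_of_ne_finset_zero fun j hj => ?_
  rw [Nat.choose_eq_zero_of_lt (by simpa [Nat.lt_succ_iff] using hj)]
  simp

theorem risingFac_mul_Gamma {x : ℝ} (hx : 0 < x) (n : ℕ) :
    risingFac x n * Real.Gamma x = Real.Gamma (x + n) := by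
  induction n with
  | zero => simp [risingFac]
  | succ n ih =>
    have hxn : x + n ≠ 0 := by positivity
    rw [Nat.cast_succ, ← add_assoc, Real.Gamma_add_one hxn, ← ih, risingFac, risingFac,
      Finset.prod_range_succ]
    ring

theorem risingFac_pos {x : ℝ} (hx : 0 < x) (n : ℕ) : 0 < risingFac x n :=
  Finset.prod_pos fun i _ => by positivity

theorem risingFac_succ (x : ℝ) (n : ℕ) : risingFac x (n + 1) = risingFac x n * (x + n) :=
  Finset.prod_range_succ _ _

/-- The Beta–Bernoulli weights in terms of rising factorials. -/
theorem VBB_eq_risingFac {α θ : ℝ} (hs : 0 < θ + α) (hθ : 0 < θ) (N n k : ℕ) :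
    VBB α θ N n k = (N.choose k : ℝ) * (-α / risingFac (θ + α) n) ^ k *
      (risingFac (θ + α) n / risingFac θ n) ^ N := by
  have hGs := (Real.Gamma_pos_of_pos hs).ne'
  have hGθ := (Real.Gamma_pos_of_pos hθ).ne'
  rw [VBB, ← risingFac_mul_Gamma hs, ← risingFac_mul_Gamma hθ, mul_div_mul_right _ _ hGs,
    mul_assoc (risingFac (θ + α) n), mul_left_comm (Real.Gamma (θ + α)),
    mul_div_mul_right _ _ (mul_ne_zero hGs hGθ)]

/-- The Beta–Bernoulli weights form an `(α,θ)`-solution. -/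
theorem stmt_9
    (α θ : ℝ) (hα : α < 0) (hθ : -α < θ) (N : ℕ) :
    HasSum (fun j => VBB α θ N 1 j) 1 ∧
    ∀ n : ℕ, 1 ≤ n → ∀ k : ℕ,
      HasSum
        (fun j : ℕ =>
          (Nat.choose (k + j) j : ℝ) * (risingFac (θ + α) n) ^ j *
            (θ + (n : ℝ)) ^ k * VBB α θ N (n + 1) (k + j))
        (VBB α θ N n k) := by
  have hs : 0 < θ + α := by linarith
  have hθ₀ : 0 < θ := by linarith
  constructor
  · have h : (1 + -α / (θ + α)) ^ N * ((θ + α) / θ) ^ N = 1 := by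
      rw [← mul_pow]
      convert one_pow N
      field_simp
      ring
    rw [← h]
    refine ((hasSum_choose_mul_pow N (-α / (θ + α))).mul_right _).congr_fun fun j => ?_
    simp [VBB_eq_risingFac hs hθ₀, risingFac]
  · intro n _ k
    simp only [VBB_eq_risingFac hs hθ₀, risingFac_succ]
    have hr := (risingFac_pos hs n).ne'
    have ht := (risingFac_pos hθ₀ n).ne'
    have hsn : θ + α + n ≠ 0 := by positivity
    have hθn : θ + n ≠ 0 := by positivity
    generalize risingFac (θ + α) n = r at hr ⊢
    generalize risingFac θ n = t at ht ⊢
    rcases lt_or_ge N k with hNk | hkN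
    · have hzero (j : ℕ) : N.choose (k + j) = 0 := Nat.choose_eq_zero_of_lt (by omega)
      simp [hzero, Nat.choose_eq_zero_of_lt hNk, hasSum_zero]
    · obtain ⟨M, rfl⟩ := Nat.exists_eq_add_of_le hkN
      have hbase : 1 + -α / (θ + α + n) = (θ + n) / (θ + α + n) := by
        field_simp
        ring
      have hsum := (hasSum_choose_mul_pow M (-α / (θ + α + n))).mul_left
        (((k + M).choose k : ℝ) * (-α / r) ^ k * (r / t) ^ (k + M) *
          ((θ + α + n) / (θ + n)) ^ M)
      rw [hbase, mul_assoc _ (((θ + α + n) / (θ + n)) ^ M), ← mul_pow, div_mul_div_cancel₀ hθn,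
        div_self hsn, one_pow, mul_one] at hsum
      refine hsum.congr_fun fun j => ?_
      have hchoose : ((k + M).choose (k + j) : ℝ) * ((k + j).choose j : ℝ) =
          ((k + M).choose k : ℝ) * (M.choose j : ℝ) := by
        have h := Nat.choose_mul (n := k + M) (k := k + j) (s := k) (by omega)
        rw [Nat.add_sub_cancel_left, Nat.add_sub_cancel_left, Nat.choose_symm_add] at h
        exact_mod_cast h
      trans ((k + M).choose (k + j) : ℝ) * ((k + j).choose j : ℝ) *
        ((-α / r) ^ k * (r / t) ^ (k + M) *
          ((θ + α + n) / (θ + n)) ^ M * (-α / (θ + α + n)) ^ j)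
      · generalize θ + α + (n : ℝ) = u at *
        generalize θ + (n : ℝ) = v at *
        simp only [div_pow, mul_pow, pow_add]
        field_simp
      · rw [hchoose]
        ring
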